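/- There is a universal constant C > 0 with the following property. Let g be a standard Gaussian random vector in ℝ^N, and for t ∈ ℝ^N let X_t = ⟨t, g⟩ (so (X_t) is a centered Gaussian process with Var X_t = ‖t‖_2²). Let T_1, …, T_k be nonempty bounded subsets of ℝ^N and T = T_1 ∪ … ∪ T_k. Then E sup_{t ∈ T} X_t ≤ max_{1 ≤ i ≤ k} E sup_{t ∈ T_i} X_t + C·max_{1 ≤ i ≤ k} √(Log i)·sup_{t ∈ T_i} ‖t‖_2. In particular, E sup_{t ∈ T} X_t ≤ max_{1 ≤ i ≤ k} E sup_{t ∈ T_i} X_t + C·√(Log k)·sup_{t ∈ T} ‖t‖_2. -/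

import Mathlib

open MeasureTheory ProbabilityTheory
open scoped ENNReal NNReal

noncomputable section

/-- The `ℓ_r` norm of a finite real vector, `r ∈ [1,∞]`. -/
def lpNorm (r : ℝ≥0∞) {ι : Type*} [Fintype ι] (x : ι → ℝ) : ℝ :=
  if r = ⊤ then ⨆ i, |x i| else (∑ i, |x i| ^ r.toReal) ^ (1 / r.toReal)

/-- The operator norm `‖M‖_{p→q}` expressed via the conjugate exponent `q*`:
the supremum of the bilinear form over `s` in the unit ball of `ℓ_{q*}` and
`t` in the unit ball of `ℓ_p`. -/
def opNorm (p qstar : ℝ≥0∞) {ι κ : Type*} [Fintype ι] [Fintype κ]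
    (M : ι → κ → ℝ) : ℝ :=
  sSup { x : ℝ | ∃ s : ι → ℝ, ∃ t : κ → ℝ,
    lpNorm qstar s ≤ 1 ∧ lpNorm p t ≤ 1 ∧ x = ∑ i, ∑ j, M i j * s i * t j }

/-- The standard Gaussian product measure on `ι → ℝ` (iid `N(0,1)` coordinates). -/
def stdGaussian (ι : Type*) [Fintype ι] : Measure (ι → ℝ) :=
  Measure.pi fun _ => gaussianReal 0 1

/-- `Log x = max 1 (ln x)`; in particular `Log 0 = 1`. -/
def Log (x : ℝ) : ℝ := max 1 (Real.log x)

/-- `E‖G_A‖_{p→q}` for the Gaussian matrix `G_A = (a_{ij} g_{ij})`. -/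
def EopNorm (p qstar : ℝ≥0∞) {m n : ℕ} (A : Fin m → Fin n → ℝ) : ℝ :=
  ∫ g : Fin m × Fin n → ℝ,
    opNorm p qstar (fun i j => A i j * g (i, j)) ∂ stdGaussian (Fin m × Fin n)

/-- `D1 = max_i ‖(a_{ij})_j‖_{p*}`. -/
def D1 (pstar : ℝ≥0∞) {m n : ℕ} (A : Fin m → Fin n → ℝ) : ℝ :=
  ⨆ i, lpNorm pstar (fun j => A i j)

/-- `D2 = max_j ‖(a_{ij})_i‖_q`. -/
def D2 (q : ℝ≥0∞) {m n : ℕ} (A : Fin m → Fin n → ℝ) : ℝ :=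
  ⨆ j, lpNorm q (fun i => A i j)

/-- `max_{i,j} |a_{ij}|`. -/
def maxEntry {m n : ℕ} (A : Fin m → Fin n → ℝ) : ℝ :=
  ⨆ ij : Fin m × Fin n, |A ij.1 ij.2|

/-- `max_{k ≥ 0} inf_{I ⊂ [m]×[n], |I| = k} √(Log k) · max_{(i,j) ∉ I} |a_{ij}|`
(for `k > mn` the term vanishes, so `k` ranges over `0,…,mn`). -/
def Dinf {m n : ℕ} (A : Fin m → Fin n → ℝ) : ℝ :=
  ⨆ k : Fin (m * n + 1),
    ⨅ I : { I : Finset (Fin m × Fin n) // I.card = k.1 },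
      Real.sqrt (Log (k.1 : ℝ)) *
        ⨆ ij : { ij : Fin m × Fin n // ij ∉ I.1 }, |A ij.1.1 ij.1.2|

/-- `E max_{i,j} |a_{ij} g_{ij}|`. -/
def EmaxGauss {m n : ℕ} (A : Fin m → Fin n → ℝ) : ℝ :=
  ∫ g : Fin m × Fin n → ℝ,
    (⨆ ij : Fin m × Fin n, |A ij.1 ij.2 * g ij|) ∂ stdGaussian (Fin m × Fin n)

section Helpers

open Real Filter Topology

variable {ι : Type*} [Fintype ι]

/-- The supremum `sup_{t ∈ T} ⟨t, g⟩` of the canonical process over `T`. -/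
def processSup (T : Set (ι → ℝ)) (g : ι → ℝ) : ℝ :=
  sSup ((fun t : ι → ℝ => ∑ x, t x * g x) '' T)

lemma isGaussian_stdGaussian_pi : IsGaussian (_root_.stdGaussian ι) := by
  have h : _root_.stdGaussian ι = (ProbabilityTheory.stdGaussian (EuclideanSpace ℝ ι)).map
      (PiLp.continuousLinearEquiv 2 ℝ (fun _ : ι => ℝ)) := by
    rw [← map_pi_eq_stdGaussian, Measure.map_map (by fun_prop) (by fun_prop)]
    exact Measure.map_id.symm
  rw [h]
  infer_instance

attribute [local instance] isGaussian_stdGaussian_pi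

lemma integral_exp_linear_stdGaussian (t : ι → ℝ) (a : ℝ) :
    ∫ g, exp (a * ∑ x, t x * g x) ∂_root_.stdGaussian ι = exp (a ^ 2 * (∑ x, t x ^ 2) / 2) := by
  have h (g : ι → ℝ) : exp (a * ∑ x, t x * g x) = ∏ x, exp ((a * t x) * g x) := by
    rw [← Real.exp_sum, Finset.mul_sum]
    simp only [mul_assoc]
  simp_rw [h]
  unfold _root_.stdGaussian
  rw [integral_fintype_prod_eq_prod (𝕜 := ℝ) (fun x y => exp ((a * t x) * y))]
  have h1 (x : ι) : ∫ y, exp ((a * t x) * y) ∂gaussianReal 0 1 = exp ((a * t x) ^ 2 / 2) := by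
    have := mgf_gaussianReal (p := gaussianReal 0 1) (X := id) (μ := 0) (v := 1) Measure.map_id
      (a * t x)
    simpa [mgf] using this
  simp_rw [h1]
  rw [← Real.exp_sum, Finset.mul_sum, Finset.sum_div]
  simp only [mul_pow]

lemma integral_id_stdGaussian : ∫ g, id g ∂_root_.stdGaussian ι = 0 := by
  ext i
  rw [eval_integral (fun i => (IsGaussian.integrable_id (μ := _root_.stdGaussian ι)).eval i)]
  unfold _root_.stdGaussian
  simp only [id]
  exact (integral_comp_eval (μ := fun _ => gaussianReal 0 1) (f := fun y : ℝ => y)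
    (by fun_prop)).trans (by simp)

lemma integrable_exp_of_abs_le_norm {E : Type*} [NormedAddCommGroup E] [NormedSpace ℝ E]
    [MeasurableSpace E] [BorelSpace E] [SecondCountableTopology E] [CompleteSpace E]
    (μ : Measure E) [IsGaussian μ] {f : E → ℝ} (hf : Continuous f) {M : ℝ}
    (hM : ∀ x, |f x| ≤ M * ‖x‖) : Integrable (fun x => exp (f x)) μ := by
  obtain ⟨C, hC, hint⟩ := IsGaussian.exists_integrable_exp_sq μ
  refine (hint.const_mul (exp (M ^ 2 / (4 * C)))).mono' (by fun_prop) (ae_of_all _ fun x => ?_)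
  rw [Real.norm_of_nonneg (exp_pos _).le, ← Real.exp_add]
  gcongr
  refine (le_abs_self _).trans ((hM x).trans ?_)
  have : M ^ 2 / (4 * C) + C * ‖x‖ ^ 2 - M * ‖x‖ = (M - 2 * C * ‖x‖) ^ 2 / (4 * C) := by
    field_simp
    ring
  have h2 : 0 ≤ (M - 2 * C * ‖x‖) ^ 2 / (4 * C) := by positivity
  linarith

section ProcessSup

variable {T : Set (ι → ℝ)} {M : ℝ}

lemma abs_linear_le (hM : ∀ t ∈ T, ∑ x, |t x| ≤ M) {t : ι → ℝ} (ht : t ∈ T) (g : ι → ℝ) :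
    |∑ x, t x * g x| ≤ M * ‖g‖ := by
  calc |∑ x, t x * g x| ≤ ∑ x, |t x| * ‖g‖ := by
        refine (Finset.abs_sum_le_sum_abs _ _).trans (Finset.sum_le_sum fun x _ => ?_)
        rw [abs_mul]
        gcongr
        exact norm_le_pi_norm g x
    _ = (∑ x, |t x|) * ‖g‖ := by rw [Finset.sum_mul]
    _ ≤ _ := by gcongr; exact hM t ht

lemma bddAbove_linear_image (hM : ∀ t ∈ T, ∑ x, |t x| ≤ M) (g : ι → ℝ) :
    BddAbove ((fun t : ι → ℝ => ∑ x, t x * g x) '' T) := by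
  refine ⟨M * ‖g‖, ?_⟩
  rintro _ ⟨t, ht, rfl⟩
  exact (le_abs_self _).trans (abs_linear_le hM ht g)

lemma le_processSup (hM : ∀ t ∈ T, ∑ x, |t x| ≤ M) {t : ι → ℝ} (ht : t ∈ T) (g : ι → ℝ) :
    ∑ x, t x * g x ≤ processSup T g :=
  le_csSup (bddAbove_linear_image hM g) ⟨t, ht, rfl⟩

lemma processSup_le (hT : T.Nonempty) {g : ι → ℝ} {B : ℝ} (h : ∀ t ∈ T, ∑ x, t x * g x ≤ B) :
    processSup T g ≤ B := by
  refine csSup_le (hT.image _) ?_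
  rintro _ ⟨t, ht, rfl⟩
  exact h t ht

lemma abs_processSup_le (hT : T.Nonempty) (hM : ∀ t ∈ T, ∑ x, |t x| ≤ M) (g : ι → ℝ) :
    |processSup T g| ≤ M * ‖g‖ := by
  obtain ⟨t, ht⟩ := hT
  refine abs_le.2 ⟨?_, processSup_le ⟨t, ht⟩ fun t ht =>
    (le_abs_self _).trans (abs_linear_le hM ht g)⟩
  exact (abs_le.1 (abs_linear_le hM ht g)).1.trans (le_processSup hM ht g)

lemma continuous_processSup (hT : T.Nonempty) (hM : ∀ t ∈ T, ∑ x, |t x| ≤ M) :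
    Continuous (processSup T) := by
  have hM0 : 0 ≤ M := by
    obtain ⟨t, ht⟩ := hT
    exact (Finset.sum_nonneg fun x _ => abs_nonneg (t x)).trans (hM t ht)
  refine (LipschitzWith.of_le_add_mul M.toNNReal fun g h => ?_).continuous
  rw [Real.coe_toNNReal _ hM0, dist_eq_norm]
  refine processSup_le hT fun t ht => ?_
  have h1 := le_processSup hM ht h
  have h2 := (le_abs_self _).trans (abs_linear_le hM ht (g - h))
  simp only [Pi.sub_apply, mul_sub, Finset.sum_sub_distrib] at h2
  linarith

lemma integrable_exp_mul_processSup (hT : T.Nonempty) (hM : ∀ t ∈ T, ∑ x, |t x| ≤ M) (a : ℝ) :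
    Integrable (fun g => exp (a * processSup T g)) (_root_.stdGaussian ι) := by
  have := continuous_processSup hT hM
  refine integrable_exp_of_abs_le_norm _ (by fun_prop) (M := |a| * M) fun g => ?_
  rw [abs_mul, mul_assoc]
  gcongr
  exact abs_processSup_le hT hM g

lemma integrable_processSup (hT : T.Nonempty) (hM : ∀ t ∈ T, ∑ x, |t x| ≤ M) :
    Integrable (processSup T) (_root_.stdGaussian ι) := by
  refine (IsGaussian.integrable_id.norm.const_mul M).mono'
    (continuous_processSup hT hM).aestronglyMeasurable (ae_of_all _ fun g => ?_)
  exact abs_processSup_le hT hM g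

lemma integrable_exp_processSup_sub (hT : T.Nonempty) (hM : ∀ t ∈ T, ∑ x, |t x| ≤ M)
    (a c s : ℝ) :
    Integrable (fun p : (ι → ℝ) × (ι → ℝ) =>
      exp (a * (processSup T p.1 - processSup T (c • p.1 + s • p.2))))
      ((_root_.stdGaussian ι).prod (_root_.stdGaussian ι)) := by
  have := continuous_processSup hT hM
  have hM0 : 0 ≤ M := by
    obtain ⟨t, ht⟩ := hT
    exact (Finset.sum_nonneg fun x _ => abs_nonneg (t x)).trans (hM t ht)
  refine integrable_exp_of_abs_le_norm _ (by fun_prop) (M := |a| * (M * (1 + |c| + |s|)))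
    fun p => ?_
  rw [abs_mul, mul_assoc]
  gcongr
  have h1 := abs_processSup_le hT hM p.1
  have h2 := abs_processSup_le hT hM (c • p.1 + s • p.2)
  have h3 : ‖c • p.1 + s • p.2‖ ≤ |c| * ‖p.1‖ + |s| * ‖p.2‖ := by
    refine (norm_add_le _ _).trans ?_
    simp [norm_smul]
  have h4 : ‖p.1‖ ≤ ‖p‖ := norm_fst_le p
  have h5 : ‖p.2‖ ≤ ‖p‖ := norm_snd_le p
  calc _ ≤ M * ‖p.1‖ + M * ‖c • p.1 + s • p.2‖ := (abs_sub _ _).trans (add_le_add h1 h2)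
    _ ≤ M * ‖p‖ + M * (|c| * ‖p‖ + |s| * ‖p‖) := by
      gcongr
      exact h3.trans (by gcongr)
    _ = _ := by ring

/-- One small rotation of the pair `(x, y)` changes the supremum, in exponential moment, by the
Gaussian bound up to the factor coming from the radial displacement. -/
lemma integral_exp_processSup_sub_le (hT : T.Nonempty) (hM : ∀ t ∈ T, ∑ x, |t x| ≤ M) {σ : ℝ}
    (hσ : ∀ t ∈ T, ∑ x, t x ^ 2 ≤ σ ^ 2) {a : ℝ} (ha : 0 ≤ a) {c : ℝ} (hc : c ≤ 1) (s : ℝ) :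
    ∫ p : (ι → ℝ) × (ι → ℝ), exp (a * (processSup T p.1 - processSup T (c • p.1 + s • p.2)))
      ∂((_root_.stdGaussian ι).prod (_root_.stdGaussian ι)) ≤
    exp (a ^ 2 * s ^ 2 * σ ^ 2 / 2) * mgf (processSup T) (_root_.stdGaussian ι) (a * (1 - c)) := by
  have hint := integrable_exp_processSup_sub hT hM a c s
  rw [integral_prod _ hint, mgf, ← integral_const_mul]
  refine integral_mono_ae hint.integral_prod_left
    ((integrable_exp_mul_processSup hT hM _).const_mul _) ?_
  filter_upwards [hint.prod_right_ae] with x hx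
  refine le_of_forall_pos_le_add fun ε hε => ?_
  have hlim : Tendsto (fun η : ℝ => exp (a * η) *
      (exp (a ^ 2 * s ^ 2 * σ ^ 2 / 2) * exp (a * (1 - c) * processSup T x))) (𝓝[>] 0)
      (𝓝 (exp (a * 0) *
      (exp (a ^ 2 * s ^ 2 * σ ^ 2 / 2) * exp (a * (1 - c) * processSup T x)))) := by
    refine (Continuous.tendsto (by fun_prop) 0).mono_left nhdsWithin_le_nhds
  rw [mul_zero, exp_zero, one_mul] at hlim
  have hle : ∀ η > 0, ∫ y, exp (a * (processSup T x - processSup T (c • x + s • y)))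
      ∂_root_.stdGaussian ι ≤ exp (a * η) *
      (exp (a ^ 2 * s ^ 2 * σ ^ 2 / 2) * exp (a * (1 - c) * processSup T x)) := by
    intro η hη
    obtain ⟨_, ⟨t, ht, rfl⟩, hlt⟩ := exists_lt_of_lt_csSup (hT.image _)
      (show processSup T x - η < processSup T x by linarith)
    simp only at hlt
    have hpt (y : ι → ℝ) : exp (a * (processSup T x - processSup T (c • x + s • y))) ≤
        exp (a * η) * exp (a * (1 - c) * processSup T x) * exp (-(a * s) * ∑ i, t i * y i) := by
      rw [← Real.exp_add, ← Real.exp_add]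
      gcongr
      have h1 := le_processSup hM ht (c • x + s • y)
      have h2 := le_processSup hM ht x
      have h3 : ∑ i, t i * (c • x + s • y) i = c * ∑ i, t i * x i + s * ∑ i, t i * y i := by
        simp only [Pi.add_apply, Pi.smul_apply, smul_eq_mul, Finset.mul_sum,
          ← Finset.sum_add_distrib]
        refine Finset.sum_congr rfl fun i _ => by ring
      rw [h3] at h1
      have h4 : processSup T x - processSup T (c • x + s • y) ≤
          η + (1 - c) * processSup T x - s * ∑ i, t i * y i := by
        have := mul_le_mul_of_nonneg_left h2 (sub_nonneg.2 hc)
        nlinarith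
      calc _ ≤ a * (η + (1 - c) * processSup T x - s * ∑ i, t i * y i) := by gcongr
        _ = _ := by ring
    have hlin : Integrable (fun y : ι → ℝ => exp (-(a * s) * ∑ i, t i * y i))
        (_root_.stdGaussian ι) := by
      refine integrable_exp_of_abs_le_norm _ (by fun_prop) (M := |-(a * s)| * M) fun g => ?_
      rw [abs_mul, mul_assoc]
      gcongr
      exact abs_linear_le hM ht g
    refine (integral_mono hx (hlin.const_mul _) hpt).trans ?_
    rw [integral_const_mul, integral_exp_linear_stdGaussian, mul_assoc,
      mul_comm (exp (a * (1 - c) * processSup T x))]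
    have hvar : (-(a * s)) ^ 2 * ∑ i, t i ^ 2 ≤ a ^ 2 * s ^ 2 * σ ^ 2 := by
      rw [neg_sq, mul_pow]
      gcongr
      exact hσ t ht
    gcongr
  refine le_trans (ge_of_tendsto hlim ?_) (le_add_of_nonneg_right hε.le)
  filter_upwards [self_mem_nhdsWithin] with η hη using hle η hη

lemma integral_exp_processSup_sub_le_of_pos (hT : T.Nonempty) (hM : ∀ t ∈ T, ∑ x, |t x| ≤ M)
    {σ : ℝ} (hσ : ∀ t ∈ T, ∑ x, t x ^ 2 ≤ σ ^ 2) {a : ℝ} (ha : 0 ≤ a) {n : ℕ} (hn : 0 < n) :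
    ∫ p : (ι → ℝ) × (ι → ℝ), exp (a * (processSup T p.1 - processSup T p.2))
      ∂((_root_.stdGaussian ι).prod (_root_.stdGaussian ι)) ≤
    exp (a ^ 2 * (π / 2) ^ 2 * σ ^ 2 / 2) *
      mgf (processSup T) (_root_.stdGaussian ι) (n * a * (1 - cos (π / 2 / n))) := by
  set δ : ℝ := π / 2 / n with hδ
  have hn' : (0 : ℝ) < n := by exact_mod_cast hn
  have hnδ : n * δ = π / 2 := by rw [hδ]; field_simp
  let H : (ι → ℝ) × (ι → ℝ) → ℝ := fun p =>
    exp (n * a * (processSup T p.1 - processSup T (cos δ • p.1 + sin δ • p.2)))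
  let Z : ℕ → (ι → ℝ) × (ι → ℝ) → (ι → ℝ) := fun j p =>
    cos (j * δ) • p.1 + sin (j * δ) • p.2
  have hcont := continuous_processSup hT hM
  have hHcont : Continuous H := by fun_prop
  have hHint : Integrable H ((_root_.stdGaussian ι).prod (_root_.stdGaussian ι)) :=
    integrable_exp_processSup_sub hT hM _ _ _
  have hrot (j : ℕ) := IsGaussian.map_rotation_eq_self
    (integral_id_stdGaussian (ι := ι)) (j * δ)
  have hHrot (j : ℕ) (p : (ι → ℝ) × (ι → ℝ)) : H (ContinuousLinearMap.rotation (j * δ) p) =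
      exp (n * a * (processSup T (Z j p) - processSup T (Z (j + 1) p))) := by
    have hZ : Z (j + 1) p = cos δ • (cos (j * δ) • p.1 + sin (j * δ) • p.2) +
        sin δ • (-sin (j * δ) • p.1 + cos (j * δ) • p.2) := by
      ext i
      simp only [Z, Nat.cast_add, Nat.cast_one, add_mul, one_mul, cos_add, sin_add,
        Pi.add_apply, Pi.smul_apply, smul_eq_mul]
      ring
    simp only [H, ContinuousLinearMap.rotation_apply]
    rw [← hZ]
  have hintj (j : ℕ) : Integrable (fun p : (ι → ℝ) × (ι → ℝ) =>
      exp (n * a * (processSup T (Z j p) - processSup T (Z (j + 1) p))))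
      ((_root_.stdGaussian ι).prod (_root_.stdGaussian ι)) := by
    rw [← hrot j] at hHint
    refine (hHint.comp_measurable (by fun_prop)).congr (ae_of_all _ fun p => ?_)
    exact hHrot j p
  have hvalj (j : ℕ) : ∫ p : (ι → ℝ) × (ι → ℝ),
      exp (n * a * (processSup T (Z j p) - processSup T (Z (j + 1) p)))
      ∂((_root_.stdGaussian ι).prod (_root_.stdGaussian ι)) =
      ∫ p, H p ∂((_root_.stdGaussian ι).prod (_root_.stdGaussian ι)) := by
    conv_rhs => rw [← hrot j]
    rw [integral_map (by fun_prop) hHcont.aestronglyMeasurable]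
    exact integral_congr_ae (ae_of_all _ fun p => (hHrot j p).symm)
  have hpt (p : (ι → ℝ) × (ι → ℝ)) : exp (a * (processSup T p.1 - processSup T p.2)) ≤
      ∑ j ∈ Finset.range n, (n : ℝ)⁻¹ *
        exp (n * a * (processSup T (Z j p) - processSup T (Z (j + 1) p))) := by
    have htel : a * (processSup T p.1 - processSup T p.2) = ∑ j ∈ Finset.range n, (n : ℝ)⁻¹ •
        (n * a * (processSup T (Z j p) - processSup T (Z (j + 1) p))) := by
      have h0 : Z 0 p = p.1 := by simp [Z]
      have h1 : Z n p = p.2 := by simp [Z, hnδ]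
      rw [← Finset.smul_sum, ← Finset.mul_sum,
        Finset.sum_range_sub' (fun j => processSup T (Z j p)), h0, h1, smul_eq_mul]
      field_simp
    rw [htel]
    refine convexOn_exp.map_sum_le (fun _ _ => by positivity) ?_ (fun _ _ => Set.mem_univ _)
    simp [hn'.ne']
  have hint0 : Integrable (fun p : (ι → ℝ) × (ι → ℝ) =>
      exp (a * (processSup T p.1 - processSup T p.2)))
      ((_root_.stdGaussian ι).prod (_root_.stdGaussian ι)) := by
    simpa using integrable_exp_processSup_sub hT hM a 0 1
  calc _ ≤ ∫ p, ∑ j ∈ Finset.range n, (n : ℝ)⁻¹ *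
        exp (n * a * (processSup T (Z j p) - processSup T (Z (j + 1) p)))
        ∂((_root_.stdGaussian ι).prod (_root_.stdGaussian ι)) :=
        integral_mono hint0 (integrable_finsetSum _ fun j _ => (hintj j).const_mul _) hpt
    _ = ∫ p, H p ∂((_root_.stdGaussian ι).prod (_root_.stdGaussian ι)) := by
        rw [integral_finsetSum _ fun j _ => (hintj j).const_mul _]
        simp_rw [integral_const_mul, hvalj]
        simp [hn'.ne']
    _ ≤ exp ((n * a) ^ 2 * sin δ ^ 2 * σ ^ 2 / 2) *
        mgf (processSup T) (_root_.stdGaussian ι) (n * a * (1 - cos δ)) :=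
        integral_exp_processSup_sub_le hT hM hσ (by positivity) (cos_le_one _) _
    _ ≤ _ := by
        have hδ0 : 0 ≤ δ := by positivity
        have h1 : sin δ ^ 2 ≤ δ ^ 2 := by
          refine sq_le_sq.2 ?_
          rw [abs_of_nonneg hδ0]
          simpa [abs_of_nonneg hδ0] using abs_sin_le_abs (x := δ)
        have h2 : (n * a) ^ 2 * sin δ ^ 2 ≤ a ^ 2 * (π / 2) ^ 2 := by
          calc (n * a) ^ 2 * sin δ ^ 2 ≤ (n * a) ^ 2 * δ ^ 2 := by gcongr
            _ = a ^ 2 * (n * δ) ^ 2 := by ring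
            _ = _ := by rw [hnδ]
        gcongr
        exact mgf_nonneg

lemma integral_exp_processSup_sub_le_of_nonneg (hT : T.Nonempty)
    (hM : ∀ t ∈ T, ∑ x, |t x| ≤ M)
    {σ : ℝ} (hσ : ∀ t ∈ T, ∑ x, t x ^ 2 ≤ σ ^ 2) {a : ℝ} (ha : 0 ≤ a) :
    ∫ p : (ι → ℝ) × (ι → ℝ), exp (a * (processSup T p.1 - processSup T p.2))
      ∂((_root_.stdGaussian ι).prod (_root_.stdGaussian ι)) ≤
    exp (a ^ 2 * (π / 2) ^ 2 * σ ^ 2 / 2) := by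
  have hmgf : Continuous (mgf (processSup T) (_root_.stdGaussian ι)) :=
    continuous_mgf fun t => integrable_exp_mul_processSup hT hM t
  have hlim0 : Tendsto (fun n : ℕ => (n : ℝ) * a * (1 - cos (π / 2 / n))) atTop (𝓝 0) := by
    have hub : Tendsto (fun n : ℕ => a * (π / 2) ^ 2 / 2 / (n : ℝ)) atTop (𝓝 0) :=
      tendsto_const_div_atTop_nhds_zero_nat _
    refine tendsto_of_tendsto_of_tendsto_of_le_of_le' tendsto_const_nhds hub
      (Eventually.of_forall fun n => ?_) ?_
    · have := cos_le_one (π / 2 / n)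
      have : 0 ≤ 1 - cos (π / 2 / n) := by linarith
      positivity
    · filter_upwards [eventually_gt_atTop 0] with n hn
      have hn' : (0 : ℝ) < n := by exact_mod_cast hn
      have h := one_sub_sq_div_two_le_cos (x := π / 2 / n)
      calc (n : ℝ) * a * (1 - cos (π / 2 / n)) ≤ n * a * ((π / 2 / n) ^ 2 / 2) := by
            gcongr
            linarith
        _ = _ := by field_simp
  have hlim := ((hmgf.tendsto 0).comp hlim0).const_mul (exp (a ^ 2 * (π / 2) ^ 2 * σ ^ 2 / 2))
  rw [mgf_zero, mul_one] at hlim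
  refine ge_of_tendsto hlim ?_
  filter_upwards [eventually_gt_atTop 0] with n hn
  exact integral_exp_processSup_sub_le_of_pos hT hM hσ ha hn

/-- Gaussian concentration of the supremum around its mean, in exponential-moment form. -/
lemma mgf_processSup_sub_integral_le (hT : T.Nonempty) (hM : ∀ t ∈ T, ∑ x, |t x| ≤ M)
    {σ : ℝ} (hσ : ∀ t ∈ T, ∑ x, t x ^ 2 ≤ σ ^ 2) {a : ℝ} (ha : 0 ≤ a) :
    ∫ g, exp (a * (processSup T g - ∫ h, processSup T h ∂_root_.stdGaussian ι))
      ∂_root_.stdGaussian ι ≤ exp (2 * a ^ 2 * σ ^ 2) := by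
  have hjensen : exp (-a * ∫ h, processSup T h ∂_root_.stdGaussian ι) ≤
      ∫ h, exp (-a * processSup T h) ∂_root_.stdGaussian ι := by
    rw [← integral_const_mul]
    exact convexOn_exp.map_integral_le continuous_exp.continuousOn isClosed_univ
      (ae_of_all _ fun _ => Set.mem_univ _) ((integrable_processSup hT hM).const_mul _)
      (integrable_exp_mul_processSup hT hM _)
  have hpi : (π / 2) ^ 2 ≤ 2 ^ 2 := by
    have := pi_le_four
    have := pi_pos
    gcongr
    linarith
  calc _ = (∫ g, exp (a * processSup T g) ∂_root_.stdGaussian ι) *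
        exp (-a * ∫ h, processSup T h ∂_root_.stdGaussian ι) := by
        rw [← integral_mul_const]
        congr with g
        rw [← Real.exp_add]
        ring_nf
    _ ≤ (∫ g, exp (a * processSup T g) ∂_root_.stdGaussian ι) *
        ∫ h, exp (-a * processSup T h) ∂_root_.stdGaussian ι := by
        gcongr
    _ = ∫ p : (ι → ℝ) × (ι → ℝ), exp (a * (processSup T p.1 - processSup T p.2))
        ∂((_root_.stdGaussian ι).prod (_root_.stdGaussian ι)) := by
        rw [← integral_prod_mul]
        congr with p
        rw [← Real.exp_add]
        ring_nf
    _ ≤ exp (a ^ 2 * (π / 2) ^ 2 * σ ^ 2 / 2) :=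
        integral_exp_processSup_sub_le_of_nonneg hT hM hσ ha
    _ ≤ _ := by
        refine exp_le_exp.2 ?_
        have := mul_le_mul_of_nonneg_left hpi (by positivity : 0 ≤ a ^ 2 * σ ^ 2)
        linarith

end ProcessSup

lemma one_le_Log (x : ℝ) : 1 ≤ Log x := le_max_left _ _

lemma lpNorm_two_eq_sqrt (t : ι → ℝ) : _root_.lpNorm 2 t = √(∑ x, t x ^ 2) := by
  simp [_root_.lpNorm, Real.sqrt_eq_rpow]

lemma lpNorm_two_le_sum_abs (t : ι → ℝ) : _root_.lpNorm 2 t ≤ ∑ x, |t x| := by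
  rw [lpNorm_two_eq_sqrt]
  refine Real.sqrt_le_iff.2 ⟨Finset.sum_nonneg fun _ _ => abs_nonneg _, ?_⟩
  simpa using Finset.sum_sq_le_sq_sum_of_nonneg (s := Finset.univ) (f := fun x => |t x|)
    fun _ _ => abs_nonneg _

lemma exists_sum_abs_le_of_isBounded {T : Set (ι → ℝ)} (hT : Bornology.IsBounded T) :
    ∃ M, ∀ t ∈ T, ∑ x, |t x| ≤ M := by
  obtain ⟨R, hR⟩ := hT.exists_norm_le
  refine ⟨∑ _x : ι, R, fun t ht => Finset.sum_le_sum fun x _ => ?_⟩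
  exact (norm_le_pi_norm t x).trans (hR t ht)

lemma sum_exp_neg_two_mul_Log_le (k : ℕ) :
    ∑ i : Fin k, exp (-2 * Log ((i.1 + 1 : ℕ) : ℝ)) ≤ 2 := by
  have h (n : ℕ) : exp (-2 * Log ((n + 1 : ℕ) : ℝ)) ≤ (((n + 1 : ℕ) : ℝ) ^ 2)⁻¹ := by
    have hpos : (0 : ℝ) < ((n + 1 : ℕ) : ℝ) := by positivity
    calc exp (-2 * Log ((n + 1 : ℕ) : ℝ)) ≤ exp (-(2 * Real.log ((n + 1 : ℕ) : ℝ))) := by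
          refine exp_le_exp.2 ?_
          have : Real.log ((n + 1 : ℕ) : ℝ) ≤ Log ((n + 1 : ℕ) : ℝ) := le_max_right _ _
          linarith
      _ = _ := by
          rw [Real.exp_neg, two_mul, Real.exp_add, Real.exp_log hpos, sq]
  rw [Fin.sum_univ_eq_sum_range (fun n => exp (-2 * Log ((n + 1 : ℕ) : ℝ)))]
  refine (Finset.sum_le_sum fun n _ => h n).trans ?_
  have h2 := sum_Ioo_inv_sq_le (α := ℝ) 0 (k + 1)
  have h3 : ∑ n ∈ Finset.range k, (((n + 1 : ℕ) : ℝ) ^ 2)⁻¹ =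
      ∑ i ∈ Finset.Ioo 0 (k + 1), ((i : ℝ) ^ 2)⁻¹ := by
    rw [Finset.range_eq_Ico, Finset.sum_Ico_add' (fun i : ℕ => ((i : ℝ) ^ 2)⁻¹) 0 k 1]
    rfl
  rw [h3]
  simpa using h2

lemma integral_processSup_iUnion_le {k : ℕ} (hk : 0 < k) {T : Fin k → Set (ι → ℝ)}
    (hT : ∀ i, (T i).Nonempty) {M : ℝ} (hM : ∀ t ∈ ⋃ i, T i, ∑ x, |t x| ≤ M) {σ : Fin k → ℝ}
    (hσ0 : ∀ i, 0 ≤ σ i) (hσ : ∀ i, ∀ t ∈ T i, _root_.lpNorm 2 t ≤ σ i) {B : ℝ} (hB : 0 < B)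
    (hσB : ∀ i : Fin k, √(Log ((i.1 + 1 : ℕ) : ℝ)) * σ i ≤ B) {m : ℝ}
    (hm : ∀ i, ∫ g, processSup (T i) g ∂_root_.stdGaussian ι ≤ m) :
    ∫ g, processSup (⋃ i, T i) g ∂_root_.stdGaussian ι ≤ m + 6 * B := by
  have hMi (i : Fin k) : ∀ t ∈ T i, ∑ x, |t x| ≤ M := fun t ht =>
    hM t (Set.mem_iUnion_of_mem i ht)
  have hne : (⋃ i, T i).Nonempty := Set.nonempty_iUnion.2 ⟨⟨0, hk⟩, hT _⟩
  have hσ2 (i : Fin k) : ∀ t ∈ T i, ∑ x, t x ^ 2 ≤ σ i ^ 2 := fun t ht => by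
    have := hσ i t ht
    rw [lpNorm_two_eq_sqrt] at this
    exact (Real.sqrt_le_left (hσ0 i)).1 this
  let l : Fin k → ℝ := fun i => Log ((i.1 + 1 : ℕ) : ℝ)
  have hl1 (i : Fin k) : 1 ≤ l i := one_le_Log _
  let E : Fin k → ℝ := fun i => ∫ g, processSup (T i) g ∂_root_.stdGaussian ι
  let Y : Fin k → (ι → ℝ) → ℝ := fun i g => exp (l i / B * (processSup (T i) g - E i))
  have hYint (i : Fin k) : Integrable (Y i) (_root_.stdGaussian ι) := by
    refine ((integrable_exp_mul_processSup (hT i) (hMi i) (l i / B)).mul_const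
      (exp (-(l i / B * E i)))).congr (ae_of_all _ fun g => ?_)
    simp only [Y]
    rw [← Real.exp_add]
    ring_nf
  have hYle (i : Fin k) : ∫ g, Y i g ∂_root_.stdGaussian ι ≤ exp (2 * l i) := by
    have hli : 0 ≤ l i := zero_le_one.trans (hl1 i)
    refine (mgf_processSup_sub_integral_le (hT i) (hMi i) (hσ2 i) (by positivity)).trans
      (exp_le_exp.2 ?_)
    have h1 : l i * σ i ^ 2 ≤ B ^ 2 := by
      have := pow_le_pow_left₀ (mul_nonneg (sqrt_nonneg _) (hσ0 i)) (hσB i) 2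
      rwa [mul_pow, Real.sq_sqrt hli] at this
    calc 2 * (l i / B) ^ 2 * σ i ^ 2 = 2 * l i * (l i * σ i ^ 2) / B ^ 2 := by ring
      _ ≤ 2 * l i * B ^ 2 / B ^ 2 := by gcongr
      _ = 2 * l i := by field_simp
  have hpt (g : ι → ℝ) : processSup (⋃ i, T i) g ≤
      (m + 4 * B) + ∑ i, B * exp (-4 * l i) * Y i g := by
    refine processSup_le hne fun t ht => ?_
    obtain ⟨i, hi⟩ := Set.mem_iUnion.1 ht
    have hli : 0 < l i := zero_lt_one.trans_le (hl1 i)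
    have h1 := le_processSup (hMi i) hi g
    have h2 : B * exp (-4 * l i) * Y i g ≤ ∑ i, B * exp (-4 * l i) * Y i g :=
      Finset.single_le_sum (f := fun i => B * exp (-4 * l i) * Y i g)
        (fun i _ => by positivity) (Finset.mem_univ i)
    have h3 : processSup (T i) g - E i - 4 * B ≤ B * exp (-4 * l i) * Y i g := by
      set z := processSup (T i) g - E i - 4 * B with hz
      have h4 : exp (-4 * l i) * Y i g = exp (l i / B * z) := by
        simp only [Y]
        rw [← Real.exp_add]
        congr 1
        rw [hz]
        field_simp
        ring
      rw [mul_assoc, h4]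
      rcases le_or_gt z 0 with hz0 | hz0
      · exact hz0.trans (by positivity)
      · calc z = B * (1 / B * z) := by field_simp
          _ ≤ B * (l i / B * z) := by gcongr; exact hl1 i
          _ ≤ B * exp (l i / B * z) := by
            gcongr
            linarith [add_one_le_exp (l i / B * z)]
    have h5 : E i ≤ m := hm i
    linarith
  calc _ ≤ ∫ g, ((m + 4 * B) + ∑ i, B * exp (-4 * l i) * Y i g) ∂_root_.stdGaussian ι :=
        integral_mono (integrable_processSup hne hM) ((integrable_const _).add
          (integrable_finsetSum _ fun i _ => (hYint i).const_mul _)) hpt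
    _ = (m + 4 * B) + ∑ i, B * exp (-4 * l i) * ∫ g, Y i g ∂_root_.stdGaussian ι := by
        rw [integral_add (integrable_const _)
          (integrable_finsetSum _ fun i _ => (hYint i).const_mul _),
          integral_finsetSum _ fun i _ => (hYint i).const_mul _]
        simp_rw [integral_const_mul]
        simp
    _ ≤ (m + 4 * B) + ∑ i, B * exp (-4 * l i) * exp (2 * l i) := by
        gcongr with i
        exact hYle i
    _ = (m + 4 * B) + B * ∑ i, exp (-2 * l i) := by
        rw [Finset.mul_sum]
        congr 1
        refine Finset.sum_congr rfl fun i _ => ?_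
        rw [mul_assoc, ← Real.exp_add]
        ring_nf
    _ ≤ (m + 4 * B) + B * 2 := by
        gcongr
        exact sum_exp_neg_two_mul_Log_le k
    _ = m + 6 * B := by ring

lemma integral_processSup_iUnion_le_of_nonneg {k : ℕ} (hk : 0 < k) {T : Fin k → Set (ι → ℝ)}
    (hT : ∀ i, (T i).Nonempty) {M : ℝ} (hM : ∀ t ∈ ⋃ i, T i, ∑ x, |t x| ≤ M) {B : ℝ}
    (hσB : ∀ i : Fin k, √(Log ((i.1 + 1 : ℕ) : ℝ)) * ⨆ t : T i, _root_.lpNorm 2 (t : ι → ℝ) ≤ B) :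
    ∫ g, processSup (⋃ i, T i) g ∂_root_.stdGaussian ι ≤
      (⨆ i, ∫ g, processSup (T i) g ∂_root_.stdGaussian ι) + 6 * B := by
  have hnorm0 (t : ι → ℝ) : 0 ≤ _root_.lpNorm 2 t := by
    rw [lpNorm_two_eq_sqrt]
    exact sqrt_nonneg _
  have hσ0 (i : Fin k) : 0 ≤ ⨆ t : T i, _root_.lpNorm 2 (t : ι → ℝ) :=
    Real.iSup_nonneg fun t => hnorm0 t
  have hσ (i : Fin k) : ∀ t ∈ T i, _root_.lpNorm 2 t ≤ ⨆ t : T i, _root_.lpNorm 2 (t : ι → ℝ) := by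
    intro t ht
    refine le_ciSup (f := fun t : T i => _root_.lpNorm 2 (t : ι → ℝ)) ⟨M, ?_⟩ ⟨t, ht⟩
    rintro _ ⟨s, rfl⟩
    exact (lpNorm_two_le_sum_abs _).trans (hM s (Set.mem_iUnion_of_mem i s.2))
  have hB0 : 0 ≤ B := (mul_nonneg (sqrt_nonneg _) (hσ0 ⟨0, hk⟩)).trans (hσB ⟨0, hk⟩)
  refine le_of_forall_pos_le_add fun ε hε => ?_
  have := integral_processSup_iUnion_le hk hT hM hσ0 hσ (B := B + ε / 6) (by positivity)
    (fun i => (hσB i).trans (by linarith))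
    (fun i => le_ciSup (f := fun i => ∫ g, processSup (T i) g ∂_root_.stdGaussian ι)
      (Set.finite_range _).bddAbove i)
  linarith

end Helpers

/-- Lemma: supremum of a Gaussian process over a finite union:
for the canonical Gaussian process `X_t = ⟨t, g⟩` on `ℝ^N` and nonempty bounded
sets `T_1, …, T_k`,
`E sup_{⋃ T_i} X ≤ max_i E sup_{T_i} X + C max_i √(Log i) sup_{t ∈ T_i} ‖t‖_2`,
and in particular
`E sup_{⋃ T_i} X ≤ max_i E sup_{T_i} X + C √(Log k) sup_{t ∈ ⋃ T_i} ‖t‖_2`. -/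
theorem gaussian_sup_union :
    ∃ C : ℝ, 0 < C ∧
      ∀ (N k : ℕ), 0 < k → ∀ T : Fin k → Set (Fin N → ℝ),
        (∀ i, (T i).Nonempty) → (∀ i, Bornology.IsBounded (T i)) →
        ((∫ g : Fin N → ℝ,
            sSup ((fun t : Fin N → ℝ => ∑ x, t x * g x) '' ⋃ i, T i)
          ∂ stdGaussian (Fin N)) ≤
          (⨆ i : Fin k, ∫ g : Fin N → ℝ,
              sSup ((fun t : Fin N → ℝ => ∑ x, t x * g x) '' T i)
            ∂ stdGaussian (Fin N)) +
            C * ⨆ i : Fin k,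
              Real.sqrt (Log ((i.1 + 1 : ℕ) : ℝ)) *
                ⨆ t : T i, lpNorm 2 (t : Fin N → ℝ)) ∧
        ((∫ g : Fin N → ℝ,
            sSup ((fun t : Fin N → ℝ => ∑ x, t x * g x) '' ⋃ i, T i)
          ∂ stdGaussian (Fin N)) ≤
          (⨆ i : Fin k, ∫ g : Fin N → ℝ,
              sSup ((fun t : Fin N → ℝ => ∑ x, t x * g x) '' T i)
            ∂ stdGaussian (Fin N)) +
            C * Real.sqrt (Log (k : ℝ)) *
              ⨆ t : (⋃ i, T i : Set (Fin N → ℝ)), lpNorm 2 (t : Fin N → ℝ)) := by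
  refine ⟨6, by norm_num, fun N k hk T hT hbdd => ?_⟩
  obtain ⟨M, hM⟩ := exists_sum_abs_le_of_isBounded (Bornology.isBounded_iUnion.2 hbdd)
  refine ⟨integral_processSup_iUnion_le_of_nonneg hk hT hM fun i => ?_, ?_⟩
  · exact le_ciSup (f := fun i : Fin k => Real.sqrt (Log ((i.1 + 1 : ℕ) : ℝ)) *
      ⨆ t : T i, _root_.lpNorm 2 (t : Fin N → ℝ)) (Set.finite_range _).bddAbove i
  · rw [mul_assoc]
    refine integral_processSup_iUnion_le_of_nonneg hk hT hM fun i => ?_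
    have hbd : BddAbove (Set.range fun t : (⋃ i, T i : Set (Fin N → ℝ)) =>
        _root_.lpNorm 2 (t : Fin N → ℝ)) := by
      refine ⟨M, ?_⟩
      rintro _ ⟨s, rfl⟩
      exact (lpNorm_two_le_sum_abs _).trans (hM s s.2)
    have hlog : Log ((i.1 + 1 : ℕ) : ℝ) ≤ Log (k : ℝ) := by
      refine max_le_max le_rfl (Real.log_le_log (by positivity) ?_)
      exact_mod_cast i.2
    have : Nonempty (T i) := (hT i).to_subtype
    have hsup : ⨆ t : T i, _root_.lpNorm 2 (t : Fin N → ℝ) ≤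
        ⨆ t : (⋃ i, T i : Set (Fin N → ℝ)), _root_.lpNorm 2 (t : Fin N → ℝ) :=
      ciSup_le fun t => le_ciSup hbd ⟨t.1, Set.mem_iUnion_of_mem i t.2⟩
    have hnn : 0 ≤ ⨆ t : T i, _root_.lpNorm 2 (t : Fin N → ℝ) := Real.iSup_nonneg fun t => by
      rw [lpNorm_two_eq_sqrt]
      exact Real.sqrt_nonneg _
    exact mul_le_mul (Real.sqrt_le_sqrt hlog) hsup hnn (Real.sqrt_nonneg _)
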